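/- arXiv:1511.00583 — 2 statements merged into one kernel-verified Lean document; each statement's English description precedes it below -/
import Mathlib

section
/- If (X, Σ) is a t-sparse set system, then disc(Σ) ≤ 2t − 1. -/
open Finset in
/-- A homogeneous system of fewer equations `∑ x ∈ S i, v x = 0` (`i ∈ D`) than unknowns `F` has a
nonzero solution supported on `F`. -/
theorem exists_ne_zero_sum_eq_zero {X I : Type*} (S : I → Finset X) (F : Finset X) (D : Finset I)
    (h : #D < #F) :
    ∃ v : X → ℝ, (∀ x, x ∉ F → v x = 0) ∧ (∃ x, v x ≠ 0) ∧ ∀ i ∈ D, ∑ x ∈ S i, v x = 0 := by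
  classical
  let E : (F → ℝ) →ₗ[ℝ] X → ℝ := Function.ExtendByZero.linearMap ℝ Subtype.val
  have hext (w : F → ℝ) (x : F) : E w x = w x := Subtype.val_injective.extend_apply w 0 x
  let L : (F → ℝ) →ₗ[ℝ] D → ℝ :=
    LinearMap.pi fun i => ∑ x ∈ S i, LinearMap.proj x ∘ₗ E
  have hker : L.ker ≠ ⊥ := LinearMap.ker_ne_bot_of_finrank_lt (by simpa using h)
  obtain ⟨w, hw, hw0⟩ := Submodule.exists_mem_ne_zero_of_ne_bot hker
  refine ⟨E w, fun x hx => ?_, ?_, fun i hi => ?_⟩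
  · exact Function.extend_apply' w (0 : X → ℝ) x (by rintro ⟨y, rfl⟩; exact hx y.2)
  · obtain ⟨x, hx⟩ := Function.ne_iff.mp hw0
    exact ⟨x, by rw [hext]; exact hx⟩
  · simpa [L] using congrFun (LinearMap.mem_ker.mp hw) ⟨i, hi⟩

/-- A line through a point of the cube `[-1, 1]^X` in direction `v ≠ 0` can be followed until a
coordinate moved by `v` reaches `±1`. -/
theorem exists_abs_add_mul_eq_one {X : Type*} [Fintype X] (a v : X → ℝ)
    (ha : ∀ x, |a x| ≤ 1) (hv : ∃ x, v x ≠ 0) :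
    ∃ s : ℝ, (∀ x, |a x + s * v x| ≤ 1) ∧ ∃ x, v x ≠ 0 ∧ |a x + s * v x| = 1 := by
  classical
  obtain ⟨x₀, hx₀, hmin⟩ := Finset.exists_min_image (Finset.univ.filter fun x => v x ≠ 0)
    (fun x => (|v x| - v x * a x) / v x ^ 2) (by simpa [Finset.Nonempty] using hv)
  have hvx₀ : v x₀ ≠ 0 := by simpa using hx₀
  have hmul (x : X) : |v x * a x| ≤ |v x| := by
    rw [abs_mul]
    exact mul_le_of_le_one_right (abs_nonneg _) (ha x)
  refine ⟨(|v x₀| - v x₀ * a x₀) / v x₀ ^ 2, fun x => ?_, x₀, hvx₀, ?_⟩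
  · by_cases hx : v x = 0
    · simpa [hx] using ha x
    · have hs := hmin x (by simpa using hx)
      have hs0 : 0 ≤ (|v x₀| - v x₀ * a x₀) / v x₀ ^ 2 :=
        div_nonneg (by linarith [(abs_le.mp (hmul x₀)).2]) (sq_nonneg _)
      set s := (|v x₀| - v x₀ * a x₀) / v x₀ ^ 2
      have hsq : 0 < v x ^ 2 := by positivity
      have hle : s * v x ^ 2 ≤ |v x| - v x * a x := (le_div_iff₀ hsq).mp hs
      have hnn : 0 ≤ s * v x ^ 2 := by positivity
      have key : |v x| * |a x + s * v x| ≤ |v x| * 1 := by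
        rw [← abs_mul, mul_one, abs_le]
        constructor <;> nlinarith [(abs_le.mp (hmul x)).1]
      exact le_of_mul_le_mul_left key (abs_pos.mpr hx)
  · have : a x₀ + (|v x₀| - v x₀ * a x₀) / v x₀ ^ 2 * v x₀ = |v x₀| / v x₀ := by
      field_simp
      ring
    rw [this, abs_div, abs_abs, div_self (abs_ne_zero.mpr hvx₀)]

/-- `b` is a point of the cube `[-1, 1]^X` that keeps all coordinates of `a` equal to `±1`. -/
def Refines {X : Type*} (a b : X → ℝ) : Prop :=
  (∀ x, |b x| ≤ 1) ∧ ∀ x, |a x| = 1 → b x = a x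

theorem Refines.trans {X : Type*} {a b c : X → ℝ} (hab : Refines a b) (hbc : Refines b c) :
    Refines a c :=
  ⟨hbc.1, fun x hx => by rw [hbc.2 x (by rwa [hab.2 x hx]), hab.2 x hx]⟩

open Finset in
/-- If `a` sums to zero over a set with at most `t` coordinates different from `±1`, then every
refinement of `a` sums to less than `2 * t` over it. -/
theorem Refines.abs_sum_lt {X : Type*} {a b : X → ℝ} (hab : Refines a b)
    (ha : ∀ x, |a x| ≤ 1) {t : ℕ} (ht : 0 < t) {A : Finset X}
    (hA : #{x ∈ A | |a x| ≠ 1} ≤ t) (h0 : ∑ x ∈ A, a x = 0) :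
    |∑ x ∈ A, b x| < 2 * t := by
  have hsum : ∑ x ∈ A, b x = ∑ x ∈ A with |a x| ≠ 1, (b x - a x) := by
    rw [sum_filter_of_ne, sum_sub_distrib, h0, sub_zero]
    intro x _ hx h1
    exact hx (by rw [hab.2 x h1, sub_self])
  rw [hsum]
  rcases (A.filter fun x => |a x| ≠ 1).eq_empty_or_nonempty with he | hne
  · simpa [he] using ht
  · calc |∑ x ∈ A with |a x| ≠ 1, (b x - a x)|
        ≤ ∑ x ∈ A with |a x| ≠ 1, |b x - a x| := abs_sum_le_sum_abs _ _
      _ < ∑ x ∈ A with |a x| ≠ 1, 2 := by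
        refine sum_lt_sum_of_nonempty hne fun x hx => ?_
        have h1 : |a x| < 1 := lt_of_le_of_ne (ha x) (mem_filter.mp hx).2
        linarith [abs_sub (b x) (a x), hab.1 x]
      _ = 2 * #{x ∈ A | |a x| ≠ 1} := by rw [sum_const, nsmul_eq_mul, mul_comm]
      _ ≤ 2 * t := by gcongr

open Finset in
/-- In a `t`-sparse system, fewer than `#F` of the sets meet a nonempty `F` in more than `t`
points. -/
theorem card_filter_lt_card_of_sparse {X I : Type*} [DecidableEq X] [Fintype I]
    (S : I → Finset X) {t : ℕ} (hS : ∀ x, #{i | x ∈ S i} ≤ t) {F : Finset X} (hF : F.Nonempty) :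
    #{i | t < #{x ∈ F | x ∈ S i}} < #F := by
  have h := card_mul_le_card_mul (s := univ.filter fun i => t < #{x ∈ F | x ∈ S i}) (t := F)
    (fun i x => x ∈ S i) (m := t + 1) (n := t) (fun i hi => (mem_filter.mp hi).2)
    (fun x _ => (card_le_card (filter_subset_filter _ (subset_univ _))).trans (hS x))
  have := hF.card_pos
  nlinarith

open Finset in
/-- Rounding step of the Beck–Fiala theorem: a point of the cube all of whose refinements have
small sums over the sets on which it is not balanced refines to a vertex of the cube with small
sums. -/
theorem exists_refines_abs_sum_lt {X I : Type*} [Fintype X] [Fintype I] [DecidableEq X]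
    (S : I → Finset X) {t : ℕ} (ht : 0 < t) (hS : ∀ x, #{i | x ∈ S i} ≤ t)
    (a : X → ℝ) (ha : ∀ x, |a x| ≤ 1)
    (hbal : ∀ i, ∑ x ∈ S i, a x = 0 ∨ ∀ b, Refines a b → |∑ x ∈ S i, b x| < 2 * t) :
    ∃ b : X → ℝ, (∀ x, |b x| = 1) ∧ ∀ i, |∑ x ∈ S i, b x| < 2 * t := by
  rcases (univ.filter fun x => |a x| ≠ 1).eq_empty_or_nonempty with he | hne
  · refine ⟨a, by simpa [filter_eq_empty_iff] using he, fun i => ?_⟩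
    rcases hbal i with h | h
    · rw [h, abs_zero]
      positivity
    · exact h a ⟨ha, fun _ _ => rfl⟩
  · obtain ⟨v, hvF, hv0, hvD⟩ :=
      exists_ne_zero_sum_eq_zero S _ _ (card_filter_lt_card_of_sparse S hS hne)
    obtain ⟨s, hs, x₀, hx₀, hx₀s⟩ := exists_abs_add_mul_eq_one a v ha hv0
    have hx₀a : |a x₀| ≠ 1 := fun h => hx₀ (hvF x₀ (by simpa using h))
    have hr : Refines a fun x => a x + s * v x :=
      ⟨hs, fun x hx => by simp [hvF x (by simpa using hx)]⟩
    have hlt : #{x | |a x + s * v x| ≠ 1} < #{x | |a x| ≠ 1} := by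
      refine card_lt_card ⟨fun x hx => ?_, fun h => ?_⟩
      · simp only [mem_filter, mem_univ, true_and] at hx ⊢
        exact fun h => hx ((congrArg abs (hr.2 x h)).trans h)
      · exact (mem_filter.mp (h (mem_filter.mpr ⟨mem_univ x₀, hx₀a⟩))).2 hx₀s
    refine exists_refines_abs_sum_lt S ht hS (fun x => a x + s * v x) hs fun i => ?_
    rcases hbal i with h | h
    · by_cases hi : t < #{x ∈ univ.filter (fun x => |a x| ≠ 1) | x ∈ S i}
      · left
        rw [sum_add_distrib, ← mul_sum, h, hvD i (by simpa using hi), mul_zero, add_zero]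
      · right
        intro b hb
        refine (hr.trans hb).abs_sum_lt ha ht ((card_le_card fun x => ?_).trans (not_lt.mp hi)) h
        simp +contextual
    · exact Or.inr fun b hb => h b (hr.trans hb)
termination_by #{x | |a x| ≠ 1}


/-- The discrepancy of a set system `S : Fin m → Finset (Fin n)`:
the minimum over colorings `χ : Fin n → {±1}` of the maximum over sets of `|χ(S_i)|`. -/
noncomputable def disc {n m : ℕ} (S : Fin m → Finset (Fin n)) : ℕ :=
  sInf {d : ℕ | ∃ χ : Fin n → ℤ, (∀ x, χ x = 1 ∨ χ x = -1) ∧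
    ∀ i : Fin m, (∑ x ∈ S i, χ x).natAbs ≤ d}

/-- Beck–Fiala: if `(X, Σ)` is `t`-sparse then `disc(Σ) ≤ 2t - 1`. -/
theorem beck_fiala (n m t : ℕ) (S : Fin m → Finset (Fin n))
    (hsparse : ∀ x : Fin n, (Finset.univ.filter fun i : Fin m => x ∈ S i).card ≤ t) :
    disc S ≤ 2 * t - 1 := by
  rcases Nat.eq_zero_or_pos t with rfl | ht
  · have hempty (i : Fin m) : S i = ∅ := by
      refine Finset.eq_empty_of_forall_notMem fun x hx => ?_
      have := Finset.card_eq_zero.mp (Nat.le_zero.mp (hsparse x))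
      exact Finset.notMem_empty i (this ▸ by simpa using hx)
    exact Nat.sInf_le ⟨fun _ => 1, fun _ => Or.inl rfl, fun i => by simp [hempty]⟩
  · obtain ⟨b, hb, hsum⟩ :=
      exists_refines_abs_sum_lt S ht hsparse 0 (by simp) (fun i => Or.inl (by simp))
    have hint (x : Fin n) : ∃ z : ℤ, (z = 1 ∨ z = -1) ∧ (z : ℝ) = b x := by
      rcases (abs_eq zero_le_one).mp (hb x) with h | h
      · exact ⟨1, Or.inl rfl, by simp [h]⟩
      · exact ⟨-1, Or.inr rfl, by simp [h]⟩
    choose χ hχ hχb using hint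
    refine Nat.sInf_le ⟨χ, hχ, fun i => ?_⟩
    have h : |∑ x ∈ S i, χ x| < 2 * (t : ℤ) := by
      have := hsum i
      simp only [← hχb] at this
      exact_mod_cast this
    rw [abs_lt] at h
    omega
end

section
/- There is an absolute constant C > 0 such that for all integers m ≥ n ≥ t ≥ 2, if (X, Σ) is a random t-sparse set system with |X| = n and |Σ| = m, then E[herdisc(Σ)] ≤ C·√(t·log t). -/
open Finset

open scoped Classical

/-- The hereditary discrepancy: the maximum of `disc` over restrictions to `Y ⊆ X`. -/
noncomputable def herdisc {n m : ℕ} (S : Fin m → Finset (Fin n)) : ℕ :=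
  Finset.univ.sup fun Y : Finset (Fin n) => disc fun i => S i ∩ Y

/-- The sample space of a random `t`-sparse set system: each element `x ∈ X`
independently gets a uniformly random `t`-element subset `T x ⊆ [m]` of set indices.
The uniform distribution on this finite set is the distribution of the random system. -/
noncomputable def sparseChoices (n m t : ℕ) : Finset (Fin n → Finset (Fin m)) :=
  Finset.univ.filter fun T => ∀ x, (T x).card = t

/-- The set system determined by membership choices `T`: `S_i = {x : i ∈ T x}`. -/
noncomputable def setsOf {n m : ℕ} (T : Fin n → Finset (Fin m)) : Fin m → Finset (Fin n) :=
  fun i => Finset.univ.filter fun x => i ∈ T x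

/-- If every element lies in at most `t` sets, then a fractional coloring rounds to a proper
coloring while changing each set sum by at most `2 * t` (Beck and Fiala). -/
theorem beck_fiala_rounding {n m t : ℕ} (S : Fin m → Finset (Fin n))
    (hS : ∀ x, #{i | x ∈ S i} ≤ t) (x : Fin n → ℝ) (hx : ∀ j, |x j| ≤ 1) :
    ∃ χ : Fin n → ℤ, (∀ j, χ j = 1 ∨ χ j = -1) ∧ (∀ j, |x j| = 1 → (χ j : ℝ) = x j) ∧
      ∀ i, |∑ j ∈ S i, ((χ j : ℝ) - x j)| ≤ 2 * t := by
  induction hN : #{j | |x j| < 1} using Nat.strong_induction_on generalizing x with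
  | _ N ih =>
  set F : Finset (Fin n) := {j | |x j| < 1} with hF
  rcases F.eq_empty_or_nonempty with hemp | hne
  · have h1 : ∀ j, |x j| = 1 := fun j => by
      by_contra h
      have : j ∈ F := by simp [hF, lt_of_le_of_ne (hx j) h]
      simp [hemp] at this
    have h2 : ∀ j, x j = 1 ∨ x j = -1 := fun j => eq_or_eq_neg_of_abs_eq (h1 j)
    have h3 : ∀ j, (((if x j = 1 then 1 else -1 : ℤ)) : ℝ) = x j := fun j => by
      rcases h2 j with h | h <;> norm_num [h]
    refine ⟨fun j => if x j = 1 then 1 else -1, fun j => ?_, fun j _ => h3 j, fun i => ?_⟩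
    · by_cases h : x j = 1 <;> simp [h]
    · rw [Finset.sum_eq_zero fun j _ => by rw [h3, sub_self]]
      simp
  set D : Finset (Fin m) := {i | t < #(S i ∩ F)} with hD
  have hDF : #D < #F := by
    have h1 : #D * (t + 1) ≤ #F * t := by
      refine Finset.card_mul_le_card_mul (fun i j => j ∈ S i) (fun i hi => ?_) (fun j _ => ?_)
      · have : Finset.bipartiteAbove (fun i j => j ∈ S i) F i = S i ∩ F := by
          ext; simp [Finset.bipartiteAbove, and_comm]
        rw [this]
        simpa [hD] using hi
      · exact (Finset.card_le_card (by intro i; simp [Finset.bipartiteBelow])).trans (hS j)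
    have := hne.card_pos
    nlinarith
  let L : (F → ℝ) →ₗ[ℝ] (D → ℝ) :=
    LinearMap.pi fun i => ∑ j : F, if (j : Fin n) ∈ S i then LinearMap.proj j else 0
  obtain ⟨z, hzL, hz0⟩ : ∃ z ∈ LinearMap.ker L, z ≠ 0 :=
    Submodule.exists_mem_ne_zero_of_ne_bot (LinearMap.ker_ne_bot_of_finrank_lt (by simpa using hDF))
  let y : Fin n → ℝ := fun j => if h : j ∈ F then z ⟨j, h⟩ else 0
  have hyF : ∀ j, j ∉ F → y j = 0 := fun j hj => by simp [y, hj]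
  have hyD : ∀ i ∈ D, ∑ j ∈ S i, y j = 0 := by
    intro i hi
    have h1 : L z ⟨i, hi⟩ = 0 := by rw [LinearMap.mem_ker.1 hzL]; rfl
    have h2 : L z ⟨i, hi⟩ = ∑ j : F, if (j : Fin n) ∈ S i then y j else 0 := by
      simp only [L, LinearMap.pi_apply, LinearMap.sum_apply]
      refine Finset.sum_congr rfl fun j _ => ?_
      split_ifs <;> simp [y]
    rw [h2, Finset.sum_coe_sort F (fun j => if j ∈ S i then y j else 0)] at h1
    rw [← h1, ← Finset.sum_filter, Finset.filter_mem_eq_inter]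
    symm
    refine Finset.sum_subset Finset.inter_subset_right fun j hj hj' => hyF j fun h => hj' ?_
    simp [h, hj]
  obtain ⟨j₀, hj₀⟩ : ∃ j, y j ≠ 0 := by
    obtain ⟨j, hj⟩ := Function.ne_iff.1 hz0
    exact ⟨j, by simpa [y] using hj⟩
  obtain ⟨j₁, hj₁, hmin⟩ := Finset.exists_min_image {j | y j ≠ 0}
    (fun j => (1 - SignType.sign (y j) * x j) / |y j|) ⟨j₀, by simpa using hj₀⟩
  simp only [Finset.mem_filter, Finset.mem_univ, true_and] at hj₁ hmin
  set l : ℝ := (1 - SignType.sign (y j₁) * x j₁) / |y j₁| with hl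
  have hsx : ∀ j, 0 ≤ 1 - (SignType.sign (y j) : ℝ) * x j := fun j => by
    have := abs_le.1 (hx j)
    rcases lt_trichotomy (y j) 0 with h | h | h <;> simp [h] <;> linarith
  have hl0 : 0 ≤ l := div_nonneg (hsx j₁) (abs_nonneg _)
  have hx' : ∀ j, |x j + l * y j| ≤ 1 := by
    intro j
    by_cases h0 : y j = 0
    · simpa [h0] using hx j
    have h1 := (le_div_iff₀ (abs_pos.2 h0)).1 (hmin j h0)
    have := abs_le.1 (hx j)
    rw [abs_le]
    rcases lt_or_gt_of_ne h0 with h | h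
    · have h2 : l * y j ≤ 0 := mul_nonpos_of_nonneg_of_nonpos hl0 h.le
      simp [h, abs_of_neg] at h1
      constructor <;> linarith
    · have h2 : 0 ≤ l * y j := mul_nonneg hl0 h.le
      simp [h, abs_of_pos] at h1
      constructor <;> linarith
  have hx1 : |x j₁ + l * y j₁| = 1 := by
    have h1 : l * |y j₁| = 1 - SignType.sign (y j₁) * x j₁ := by
      rw [hl, div_mul_cancel₀ _ (abs_pos.2 hj₁).ne']
    rcases lt_or_gt_of_ne hj₁ with h | h
    · simp [h, abs_of_neg] at h1
      rw [show x j₁ + l * y j₁ = -1 by linarith]; simp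
    · simp [h, abs_of_pos] at h1
      rw [show x j₁ + l * y j₁ = 1 by linarith]; simp
  have hj₁F : j₁ ∈ F := by_contra fun h => hj₁ (hyF _ h)
  have hfix : ∀ j, j ∉ F → x j + l * y j = x j := fun j hj => by simp [hyF j hj]
  obtain ⟨χ, hχ, hχ1, hχs⟩ := ih _ (by
    rw [← hN]
    refine Finset.card_lt_card (Finset.ssubset_iff_of_subset (fun j hj => ?_) |>.2 ⟨j₁, hj₁F, ?_⟩)
    · by_contra h
      have := hfix j h
      simp only [Finset.mem_filter, Finset.mem_univ, true_and] at hj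
      rw [this] at hj
      exact h (by simpa [hF] using hj)
    · simp [hx1]) (fun j => x j + l * y j) hx' rfl
  have hχF : ∀ j, j ∉ F → (χ j : ℝ) = x j := fun j hj => by
    rw [← hfix j hj]
    refine hχ1 j ?_
    rw [hfix j hj]
    simp [hF] at hj
    exact le_antisymm (hx j) hj
  refine ⟨χ, hχ, fun j hj => hχF j (by simp [hF, hj]), fun i => ?_⟩
  by_cases hi : i ∈ D
  · have h1 := hχs i
    have h2 : ∑ j ∈ S i, ((χ j : ℝ) - (x j + l * y j)) = ∑ j ∈ S i, ((χ j : ℝ) - x j) := by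
      simp only [Finset.sum_sub_distrib, Finset.sum_add_distrib, ← Finset.mul_sum, hyD i hi]
      ring
    rwa [h2] at h1
  · have h1 : ∑ j ∈ S i, ((χ j : ℝ) - x j) = ∑ j ∈ S i ∩ F, ((χ j : ℝ) - x j) := by
      symm
      refine Finset.sum_subset Finset.inter_subset_left fun j hj hj' => ?_
      rw [hχF j fun h => hj' (by simp [hj, h]), sub_self]
    have h2 : (#(S i ∩ F) : ℝ) ≤ t := by
      have : #(S i ∩ F) ≤ t := by simpa [hD] using hi
      exact_mod_cast this
    rw [h1]
    calc |∑ j ∈ S i ∩ F, ((χ j : ℝ) - x j)| ≤ ∑ j ∈ S i ∩ F, |(χ j : ℝ) - x j| :=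
          Finset.abs_sum_le_sum_abs _ _
      _ ≤ ∑ j ∈ S i ∩ F, 2 := by
          refine Finset.sum_le_sum fun j _ => ?_
          have := abs_le.1 (hx j)
          rw [abs_le]
          rcases hχ j with h | h <;> rw [h] <;> push_cast <;> constructor <;> linarith
      _ ≤ 2 * t := by simp; linarith

theorem disc_le {n m d : ℕ} {S : Fin m → Finset (Fin n)} (χ : Fin n → ℤ)
    (hχ : ∀ x, χ x = 1 ∨ χ x = -1) (h : ∀ i, (∑ x ∈ S i, χ x).natAbs ≤ d) : disc S ≤ d :=
  Nat.sInf_le ⟨χ, hχ, h⟩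

theorem herdisc_le_of_sparse {n m t : ℕ} (S : Fin m → Finset (Fin n))
    (hS : ∀ x, #{i | x ∈ S i} ≤ t) : herdisc S ≤ 2 * t := by
  refine Finset.sup_le fun Y _ => ?_
  obtain ⟨χ, hχ, -, h⟩ := beck_fiala_rounding (t := t) (fun i => S i ∩ Y)
    (fun x => (Finset.card_le_card fun i => by simp +contextual).trans (hS x)) 0 (by simp)
  refine disc_le χ hχ fun i => ?_
  have h1 := h i
  simp only [Pi.zero_apply, sub_zero] at h1
  have h2 : |∑ x ∈ S i ∩ Y, χ x| ≤ 2 * t := by exact_mod_cast h1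
  rw [Int.abs_eq_natAbs] at h2
  exact_mod_cast h2

section LocalLemma

variable {ι β κ : Type*} [Fintype ι] [Fintype β]

/-- Events determined by complementary sets of coordinates are independent. -/
theorem card_filter_and_mul_card (V : Finset ι) (P Q : (ι → β) → Prop)
    (hP : ∀ ω ω', (∀ i ∈ V, ω i = ω' i) → P ω → P ω')
    (hQ : ∀ ω ω', (∀ i ∉ V, ω i = ω' i) → Q ω → Q ω') :
    #{ω | P ω ∧ Q ω} * #(univ : Finset (ι → β)) = #{ω | P ω} * #{ω | Q ω} := by
  rw [← Finset.card_product, ← Finset.card_product]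
  let swap : (ι → β) × (ι → β) → (ι → β) × (ι → β) :=
    fun z => (V.piecewise z.1 z.2, V.piecewise z.2 z.1)
  have hswap : ∀ z, swap (swap z) = z := fun z => by
    ext i <;> by_cases h : i ∈ V <;> simp [swap, h]
  refine Finset.card_nbij' swap swap (fun z hz => ?_) (fun z hz => ?_)
    (fun z _ => hswap z) (fun z _ => hswap z)
  · simp only [Finset.coe_product, Finset.coe_filter, Finset.mem_univ, true_and, Set.mem_prod,
      Set.mem_ofPred_eq, Finset.coe_univ, Set.mem_univ, and_true] at hz ⊢
    exact ⟨hP z.1 _ (fun i hi => by simp [swap, hi]) hz.1,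
      hQ z.1 _ (fun i hi => by simp [swap, hi]) hz.2⟩
  · simp only [Finset.coe_product, Finset.coe_filter, Finset.mem_univ, true_and, Set.mem_prod,
      Set.mem_ofPred_eq, Finset.coe_univ, Set.mem_univ, and_true] at hz ⊢
    exact ⟨hP z.1 _ (fun i hi => by simp [swap, hi]) hz.1,
      hQ z.2 _ (fun i hi => by simp [swap, hi]) hz.2⟩

/-- The inductive estimate behind the local lemma: conditioning on avoiding the events in `s`
at most doubles the probability bound. -/
theorem card_filter_and_avoid_le (A : κ → (ι → β) → Prop) (V : κ → Finset ι)
    (hA : ∀ k ω ω', (∀ i ∈ V k, ω i = ω' i) → A k ω → A k ω') {p : ℝ} {d : ℕ}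
    (hp : ∀ k, (#{ω | A k ω} : ℝ) ≤ p * #(univ : Finset (ι → β)))
    (hd : ∀ k (s : Finset κ), #{l ∈ s | ¬Disjoint (V k) (V l)} ≤ d)
    (hp0 : 0 ≤ p) (h : 4 * p * d ≤ 1) (s : Finset κ) (k : κ) :
    (#{ω | A k ω ∧ ∀ l ∈ s, ¬A l ω} : ℝ) ≤ 2 * p * #{ω | ∀ l ∈ s, ¬A l ω} := by
  rcases isEmpty_or_nonempty (ι → β) with hE | hE
  · simp [Finset.univ_eq_empty]
  have hU : (0 : ℝ) < #(univ : Finset (ι → β)) := by exact_mod_cast Finset.univ_nonempty.card_pos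
  induction s using Finset.strongInduction generalizing k with
  | _ s ih =>
  set s₁ := {l ∈ s | ¬Disjoint (V k) (V l)} with hs₁
  set s₂ := {l ∈ s | Disjoint (V k) (V l)} with hs₂
  have hs₂s : s₂ ⊆ s := Finset.filter_subset _ _
  have hfar : (#{ω | A k ω ∧ ∀ l ∈ s₂, ¬A l ω} : ℝ) ≤ p * #{ω | ∀ l ∈ s₂, ¬A l ω} := by
    have h1 := card_filter_and_mul_card (V k) (A k) (fun ω => ∀ l ∈ s₂, ¬A l ω) (hA k)
      (fun ω ω' hω hQ l hl hAl => hQ l hl (hA l ω' ω (fun i hi => (hω i fun hi' =>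
        Finset.disjoint_left.1 (Finset.mem_filter.1 hl).2 hi' hi).symm) hAl))
    have h2 : (#{ω | A k ω ∧ ∀ l ∈ s₂, ¬A l ω} : ℝ) * #(univ : Finset (ι → β))
        = #{ω | A k ω} * #{ω | ∀ l ∈ s₂, ¬A l ω} := by
      norm_cast
      convert h1
    refine le_of_mul_le_mul_right ?_ hU
    rw [h2]
    calc _ ≤ (p * #(univ : Finset (ι → β))) * #{ω | ∀ l ∈ s₂, ¬A l ω} := by
          gcongr; exact hp k
      _ = _ := by ring
  have hmono : (#{ω | A k ω ∧ ∀ l ∈ s, ¬A l ω} : ℝ) ≤ #{ω | A k ω ∧ ∀ l ∈ s₂, ¬A l ω} := by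
    exact_mod_cast Finset.card_le_card fun ω => by
      simp only [Finset.mem_filter, Finset.mem_univ, true_and]
      exact fun hω => ⟨hω.1, fun l hl => hω.2 l (hs₂s hl)⟩
  have hhalf : (#{ω | ∀ l ∈ s₂, ¬A l ω} : ℝ) ≤ 2 * #{ω | ∀ l ∈ s, ¬A l ω} := by
    rcases s₁.eq_empty_or_nonempty with he | hne
    · have : s₂ = s := by
        rw [hs₂, Finset.filter_eq_self]
        intro l hl
        by_contra hl'
        have : l ∈ s₁ := by simp [hs₁, hl, hl']
        simp [he] at this
      rw [this]
      have : (0 : ℝ) ≤ #{ω | ∀ l ∈ s, ¬A l ω} := by positivity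
      linarith
    have hlt : s₂ ⊂ s := by
      obtain ⟨l, hl⟩ := hne
      refine (Finset.ssubset_iff_of_subset hs₂s).2 ⟨l, (Finset.mem_filter.1 hl).1, fun h' => ?_⟩
      exact (Finset.mem_filter.1 hl).2 (Finset.mem_filter.1 h').2
    have hcover : #{ω | ∀ l ∈ s₂, ¬A l ω} ≤ #{ω | ∀ l ∈ s, ¬A l ω} +
        ∑ l ∈ s₁, #{ω | A l ω ∧ ∀ l ∈ s₂, ¬A l ω} := by
      refine le_trans ?_ (Nat.add_le_add_left Finset.card_biUnion_le _)
      refine le_trans (Finset.card_le_card fun ω hω => ?_) (Finset.card_union_le _ _)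
      simp only [Finset.mem_filter, Finset.mem_univ, true_and, Finset.mem_union,
        Finset.mem_biUnion] at hω ⊢
      by_cases hall : ∀ l ∈ s, ¬A l ω
      · exact Or.inl hall
      push Not at hall
      obtain ⟨l, hl, hAl⟩ := hall
      exact Or.inr ⟨l, Finset.mem_filter.2
        ⟨hl, fun hdis => hω l (Finset.mem_filter.2 ⟨hl, hdis⟩) hAl⟩, hAl, hω⟩
    have hcover' : (#{ω | ∀ l ∈ s₂, ¬A l ω} : ℝ) ≤ #{ω | ∀ l ∈ s, ¬A l ω} +
        ∑ l ∈ s₁, (#{ω | A l ω ∧ ∀ l ∈ s₂, ¬A l ω} : ℝ) := by exact_mod_cast hcover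
    have hsum : ∑ l ∈ s₁, (#{ω | A l ω ∧ ∀ l ∈ s₂, ¬A l ω} : ℝ) ≤
        d * (2 * p * #{ω | ∀ l ∈ s₂, ¬A l ω}) := by
      refine (Finset.sum_le_card_nsmul _ _ _ fun l _ => ih s₂ hlt l).trans ?_
      rw [nsmul_eq_mul]
      gcongr
      exact hd k s
    have hN : (0 : ℝ) ≤ #{ω | ∀ l ∈ s₂, ¬A l ω} := by positivity
    nlinarith
  calc _ ≤ _ := hmono
    _ ≤ _ := hfar
    _ ≤ p * (2 * #{ω | ∀ l ∈ s, ¬A l ω}) := by gcongr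
    _ = _ := by ring

/-- The symmetric Lovász local lemma for events determined by few independent uniform
coordinates. -/
theorem exists_forall_not_of_local [Nonempty β] (A : κ → (ι → β) → Prop) (V : κ → Finset ι)
    (hA : ∀ k ω ω', (∀ i ∈ V k, ω i = ω' i) → A k ω → A k ω') {p : ℝ} {d : ℕ}
    (hp : ∀ k, (#{ω | A k ω} : ℝ) ≤ p * #(univ : Finset (ι → β)))
    (hd : ∀ k (s : Finset κ), #{l ∈ s | ¬Disjoint (V k) (V l)} ≤ d)
    (hp0 : 0 ≤ p) (hp1 : 2 * p < 1) (h : 4 * p * d ≤ 1) (s : Finset κ) :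
    ∃ ω, ∀ k ∈ s, ¬A k ω := by
  suffices 0 < #{ω | ∀ k ∈ s, ¬A k ω} by
    obtain ⟨ω, hω⟩ := Finset.card_pos.1 this
    exact ⟨ω, by simpa using hω⟩
  induction s using Finset.induction_on with
  | empty => simp [Fintype.card_pos]
  | insert k s _ ih =>
    have h1 := card_filter_and_avoid_le A V hA hp hd hp0 h s k
    have h2 : #{ω | ∀ l ∈ s, ¬A l ω} ≤
        #{ω | ∀ l ∈ insert k s, ¬A l ω} + #{ω | A k ω ∧ ∀ l ∈ s, ¬A l ω} := by
      refine le_trans (Finset.card_le_card fun ω hω => ?_) (Finset.card_union_le _ _)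
      simp only [Finset.mem_filter, Finset.mem_univ, true_and, Finset.mem_union,
        Finset.forall_mem_insert] at hω ⊢
      tauto
    have h3 : (#{ω | ∀ l ∈ s, ¬A l ω} : ℝ) ≤
        #{ω | ∀ l ∈ insert k s, ¬A l ω} + #{ω | A k ω ∧ ∀ l ∈ s, ¬A l ω} := by exact_mod_cast h2
    have h4 : (0 : ℝ) < #{ω | ∀ l ∈ s, ¬A l ω} := by exact_mod_cast ih
    have h5 : (0 : ℝ) < #{ω | ∀ l ∈ insert k s, ¬A l ω} := by nlinarith
    exact_mod_cast h5

end LocalLemma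

section Chernoff

/-- The sign of a Boolean. -/
def boolSign (b : Bool) : ℤ := if b then 1 else -1

theorem boolSign_eq (b : Bool) : boolSign b = 1 ∨ boolSign b = -1 := by
  cases b <;> simp [boolSign]

variable {ι : Type*} [Fintype ι]

/-- Exponential-moment bound for a sum of independent random signs. -/
theorem card_filter_le_sum_boolSign (c : ι → ℤ) {v l : ℝ} (hv : 0 < v)
    (hc : ∑ i, (c i : ℝ) ^ 2 ≤ v) (hl : 0 ≤ l) :
    (#{ω : ι → Bool | l ≤ ∑ i, (c i : ℝ) * boolSign (ω i)} : ℝ) ≤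
      Real.exp (-(l ^ 2 / (2 * v))) * #(univ : Finset (ι → Bool)) := by
  set θ := l / v with hθ
  have hθ0 : 0 ≤ θ := by positivity
  have h1 : ∑ ω : ι → Bool, Real.exp (θ * ∑ i, (c i : ℝ) * boolSign (ω i)) ≤
      Real.exp (θ ^ 2 * v / 2) * #(univ : Finset (ι → Bool)) := by
    have h2 : ∀ ω : ι → Bool, Real.exp (θ * ∑ i, (c i : ℝ) * boolSign (ω i)) =
        ∏ i, Real.exp (θ * (c i * boolSign (ω i))) := fun ω => by
      rw [Finset.mul_sum, Real.exp_sum]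
    simp_rw [h2]
    rw [← Fintype.prod_sum (fun i b => Real.exp (θ * (c i * boolSign b)))]
    have h3 : ∀ i, ∑ b, Real.exp (θ * (c i * boolSign b)) ≤
        2 * Real.exp ((θ * c i) ^ 2 / 2) := fun i => by
      have := Real.cosh_le_exp_half_sq (θ * c i)
      rw [Real.cosh_eq] at this
      simp [boolSign]
      linarith
    refine (Finset.prod_le_prod (fun i _ => by positivity) fun i _ => h3 i).trans ?_
    rw [Finset.prod_mul_distrib, ← Real.exp_sum]
    simp only [Finset.prod_const, Finset.card_univ, Fintype.card_pi, Fintype.card_bool]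
    push_cast
    rw [mul_comm]
    gcongr
    simp_rw [mul_pow, mul_div_assoc, ← Finset.mul_sum, ← Finset.sum_div]
    gcongr
  have h4 : (#{ω : ι → Bool | l ≤ ∑ i, (c i : ℝ) * boolSign (ω i)} : ℝ) * Real.exp (θ * l) ≤
      ∑ ω : ι → Bool, Real.exp (θ * ∑ i, (c i : ℝ) * boolSign (ω i)) := by
    rw [← nsmul_eq_mul]
    refine (Finset.card_nsmul_le_sum _ _ _ fun ω hω => ?_).trans
      (Finset.sum_le_sum_of_subset_of_nonneg (Finset.filter_subset _ _)
        fun _ _ _ => (Real.exp_pos _).le)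
    gcongr
    simpa using hω
  refine le_of_mul_le_mul_right (h4.trans (h1.trans_eq ?_)) (Real.exp_pos (θ * l))
  rw [mul_right_comm, ← Real.exp_add]
  congr 2
  rw [hθ]
  field_simp
  ring

theorem card_filter_le_abs_sum_boolSign (c : ι → ℤ) {v l : ℝ} (hv : 0 < v)
    (hc : ∑ i, (c i : ℝ) ^ 2 ≤ v) (hl : 0 ≤ l) :
    (#{ω : ι → Bool | l ≤ |∑ i, (c i : ℝ) * boolSign (ω i)|} : ℝ) ≤
      2 * Real.exp (-(l ^ 2 / (2 * v))) * #(univ : Finset (ι → Bool)) := by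
  have h1 := card_filter_le_sum_boolSign c hv hc hl
  have h2 := card_filter_le_sum_boolSign (fun i => -c i) hv (by simpa using hc) hl
  have h3 : #{ω : ι → Bool | l ≤ |∑ i, (c i : ℝ) * boolSign (ω i)|} ≤
      #{ω : ι → Bool | l ≤ ∑ i, (c i : ℝ) * boolSign (ω i)} +
      #{ω : ι → Bool | l ≤ ∑ i, ((-c i : ℤ) : ℝ) * boolSign (ω i)} := by
    refine le_trans (Finset.card_le_card fun ω hω => ?_) (Finset.card_union_le _ _)
    simpa [le_abs, Finset.filter_or] using hω
  have h4 : (#{ω : ι → Bool | l ≤ |∑ i, (c i : ℝ) * boolSign (ω i)|} : ℝ) ≤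
      #{ω : ι → Bool | l ≤ ∑ i, (c i : ℝ) * boolSign (ω i)} +
      #{ω : ι → Bool | l ≤ ∑ i, ((-c i : ℤ) : ℝ) * boolSign (ω i)} := by exact_mod_cast h3
  linarith

end Chernoff

/-- Elements of `Y` can be matched up within the classes of `a`, leaving out at most one element of
each class; `p` sends an element to the representative of its pair, and `s` gives the two elements
of a pair opposite signs. -/
theorem exists_pairing {X α : Type*} [DecidableEq X] [DecidableEq α] (a : X → α) (Y : Finset X) :
    ∃ (p : X → X) (s : X → ℤ), (∀ x, s x = 1 ∨ s x = -1) ∧ (∀ x ∈ Y, p x ∈ Y) ∧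
      (∀ z, #{x ∈ Y | p x = z} ≤ 2) ∧
      ∀ (c : α) (e : X → ℤ), (∀ x, e x = 1 ∨ e x = -1) →
        |∑ x ∈ Y with a x = c, s x * e (p x)| ≤ 1 := by
  induction Y using Finset.strongInduction with
  | _ Y ih =>
  by_cases hinj : Set.InjOn a Y
  · refine ⟨id, fun _ => 1, fun _ => Or.inl rfl, fun x hx => hx, fun z => ?_, fun c e he => ?_⟩
    · refine le_trans (Finset.card_le_card (t := {z}) fun x hx => ?_) (by simp)
      simpa using (Finset.mem_filter.1 hx).2
    · have hcard : #{x ∈ Y | a x = c} ≤ 1 := by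
        refine Finset.card_le_one.2 fun x hx y hy => ?_
        simp only [Finset.mem_filter] at hx hy
        exact hinj hx.1 hy.1 (hx.2.trans hy.2.symm)
      refine (Finset.abs_sum_le_sum_abs _ _).trans ?_
      refine (Finset.sum_le_card_nsmul _ _ 1 fun x _ => ?_).trans (by simpa using hcard)
      rcases he x with h | h <;> simp [h]
  · simp only [Set.InjOn, not_forall] at hinj
    obtain ⟨u, hu, v, hv, huv, hne⟩ := hinj
    rw [Finset.mem_coe] at hu hv
    set Z := (Y.erase u).erase v with hZ
    have huZ : u ∉ Z := by simp [hZ]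
    have hvZ : v ∉ Z := by simp [hZ]
    have hY : Y = insert u (insert v Z) := by
      rw [hZ, Finset.insert_erase (by simp [hv, Ne.symm hne]), Finset.insert_erase hu]
    have hZY : Z ⊂ Y := (Finset.ssubset_iff_of_subset
      ((Finset.erase_subset _ _).trans (Finset.erase_subset _ _))).2 ⟨u, hu, huZ⟩
    obtain ⟨p, s, hs, hp, hfib, hsum⟩ := ih Z hZY
    have hZu : ∀ x ∈ Z, x ≠ u ∧ x ≠ v := fun x hx =>
      ⟨fun h => huZ (h ▸ hx), fun h => hvZ (h ▸ hx)⟩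
    refine ⟨fun x => if x = u ∨ x = v then u else p x,
      fun x => if x = u then 1 else if x = v then -1 else s x, fun x => ?_, fun x hx => ?_,
      fun z => ?_, fun c e he => ?_⟩
    · dsimp only
      split_ifs <;> simp [hs]
    · by_cases h : x = u ∨ x = v
      · simpa [h] using hu
      · simp only [h, if_false]
        push Not at h
        exact hZY.1 (hp x (by simp [hZ, hx, h]))
    · by_cases hz : z = u
      · refine le_trans (Finset.card_le_card (t := {u, v}) fun x hx => ?_) Finset.card_le_two
        by_contra hx'
        simp only [Finset.mem_insert, Finset.mem_singleton] at hx'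
        simp only [Finset.mem_filter, hx', if_false] at hx
        push Not at hx'
        have h1 := hp x (by simp [hZ, hx.1, hx'])
        rw [hx.2, hz] at h1
        exact huZ h1
      · refine (Finset.card_le_card fun x hx => ?_).trans (hfib z)
        simp only [Finset.mem_filter] at hx ⊢
        by_cases h : x = u ∨ x = v
        · simp only [h, if_true] at hx
          exact absurd hx.2.symm hz
        · simp only [h, if_false] at hx
          push Not at h
          exact ⟨by simp [hZ, hx.1, h], hx.2⟩
    · have hZc : ∑ x ∈ Z with a x = c, (if x = u then 1 else if x = v then -1 else s x) *
          e (if x = u ∨ x = v then u else p x) = ∑ x ∈ Z with a x = c, s x * e (p x) := by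
        refine Finset.sum_congr rfl fun x hx => ?_
        have := hZu x (Finset.mem_filter.1 hx).1
        simp [this]
      have huv' : u ∉ insert v Z := by simp [hne, huZ]
      rw [hY, Finset.filter_insert, Finset.filter_insert, ← huv]
      by_cases hc : a u = c
      · rw [if_pos hc, if_pos hc, Finset.sum_insert (by simp [hne, huZ]),
          Finset.sum_insert (by simp [hvZ]), hZc]
        simpa [Ne.symm hne] using hsum c e he
      · rw [if_neg hc, if_neg hc, hZc]
        exact hsum c e he

/-- If every nonempty subfamily `A` of a family of sets contains a member sharing at most `k`
elements with the rest of `A`, then each element can be assigned to a set containing it so that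
every set of the family loses at most `k` of its elements. -/
theorem exists_assignment {X κ : Type*} [Fintype X] [DecidableEq κ] (T : X → Finset κ) (k : ℕ)
    (F : Finset κ)
    (h : ∀ A ⊆ F, A.Nonempty → ∃ i ∈ A, #{x | i ∈ T x ∧ 2 ≤ #(T x ∩ A)} ≤ k) :
    ∃ a : X → Option κ, (∀ x i, a x = some i → i ∈ T x ∩ F) ∧
      ∀ i ∈ F, #{x | i ∈ T x ∧ a x ≠ some i} ≤ k := by
  induction F using Finset.strongInduction with
  | _ F ih =>
  rcases F.eq_empty_or_nonempty with he | hne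
  · exact ⟨fun _ => none, by simp, by simp [he]⟩
  obtain ⟨i, hi, hik⟩ := h F subset_rfl hne
  obtain ⟨a, ha, hak⟩ := ih (F.erase i) (Finset.erase_ssubset hi)
    fun A hA => h A (hA.trans (Finset.erase_subset _ _))
  refine ⟨fun x => if a x = none ∧ i ∈ T x then some i else a x, fun x j hj => ?_,
    fun j hj => ?_⟩
  · dsimp only at hj
    by_cases hx : a x = none ∧ i ∈ T x
    · rw [if_pos hx, Option.some_inj] at hj
      rw [← hj]
      exact Finset.mem_inter.2 ⟨hx.2, hi⟩
    · rw [if_neg hx] at hj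
      exact Finset.inter_subset_inter_left (Finset.erase_subset _ _) (ha x j hj)
  · by_cases hji : j = i
    · subst hji
      refine (Finset.card_le_card fun x hx => ?_).trans hik
      simp only [Finset.mem_filter, Finset.mem_univ, true_and] at hx ⊢
      refine ⟨hx.1, ?_⟩
      have hax : a x ≠ none := fun h0 => hx.2 (by simp [h0, hx.1])
      obtain ⟨l, hl⟩ := Option.ne_none_iff_exists'.1 hax
      have hl' := ha x l hl
      simp only [Finset.mem_inter, Finset.mem_erase] at hl'
      exact Finset.one_lt_card.2 ⟨l, by simp [hl'], j, by simp [hx.1, hi], hl'.2.1⟩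
    · refine (Finset.card_le_card fun x hx => ?_).trans (hak j (by simp [hji, hj]))
      simp only [Finset.mem_filter, Finset.mem_univ, true_and] at hx ⊢
      refine ⟨hx.1, fun h0 => hx.2 ?_⟩
      simp [h0]

theorem two_le_exp_mul {t : ℕ} (ht : 2 ≤ t) :
    (512 : ℝ) ≤ t ^ 9 ∧ 2 * Real.exp (-((20 * √(t * Real.log t)) ^ 2 / (2 * (16 * t)))) ≤
      2 / t ^ 9 ∧ (4 : ℝ) * (2 / t ^ 9) * (16 * t ^ 2 : ℕ) ≤ 1 := by
  have ht' : (2 : ℝ) ≤ t := by exact_mod_cast ht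
  have ht0 : (0 : ℝ) < t := by linarith
  have hlog : 0 ≤ Real.log t := Real.log_nonneg (by linarith)
  refine ⟨?_, ?_, ?_⟩
  · calc (512 : ℝ) = 2 ^ 9 := by norm_num
      _ ≤ _ := by gcongr
  · rw [div_eq_mul_inv 2, ← Real.exp_log (pow_pos ht0 9), ← Real.exp_neg, Real.log_pow]
    gcongr
    rw [mul_pow, Real.sq_sqrt (by positivity)]
    rw [le_div_iff₀ (by positivity)]
    push_cast
    nlinarith [mul_nonneg ht0.le hlog]
  · have h7 : (2 : ℝ) ^ 7 ≤ t ^ 7 := by gcongr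
    push_cast
    have : (4 : ℝ) * (2 / t ^ 9) * (16 * t ^ 2) = 2 ^ 7 / t ^ 7 := by
      field_simp
      norm_num
    rw [this, div_le_one (by positivity)]
    exact h7

/-- If elements are tied together in pairs by `p` and each lies in at most `t` of the sets `S i`,
all of size at most `8 * t`, then signs for the pairs can be chosen so that every set has
discrepancy `O(√(t log t))`. -/
theorem exists_signs_of_card_le {X κ : Type*} [Fintype X] [DecidableEq X] [DecidableEq κ] {t : ℕ}
    (ht : 2 ≤ t) (T : X → Finset κ) (hT : ∀ x, #(T x) ≤ t) (Y : Finset X) (S : κ → Finset X)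
    (hSY : ∀ i, S i ⊆ Y) (hST : ∀ i, ∀ x ∈ S i, i ∈ T x) (hS : ∀ i, #(S i) ≤ 8 * t)
    (p : X → X) (s : X → ℤ) (hs : ∀ x, s x = 1 ∨ s x = -1) (hfib : ∀ z, #{x ∈ Y | p x = z} ≤ 2)
    (F : Finset κ) :
    ∃ ω : X → Bool, ∀ i ∈ F,
      ((∑ x ∈ S i, s x * boolSign (ω (p x))).natAbs : ℝ) < 20 * √(t * Real.log t) := by
  set l : ℝ := 20 * √(t * Real.log t) with hl
  have hl0 : 0 ≤ l := by positivity
  have ht0 : (0 : ℝ) < t := by exact_mod_cast (by lia : 0 < t)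
  let c : κ → X → ℤ := fun i z => ∑ x ∈ S i with p x = z, s x
  have hcsum : ∀ i (ω : X → Bool), ∑ z, (c i z : ℝ) * boolSign (ω z) =
      ((∑ x ∈ S i, s x * boolSign (ω (p x)) : ℤ) : ℝ) := by
    intro i ω
    rw [← Finset.sum_fiberwise (S i) p]
    push_cast
    refine Finset.sum_congr rfl fun z _ => ?_
    simp only [c]
    push_cast
    rw [Finset.sum_mul]
    refine Finset.sum_congr rfl fun x hx => ?_
    rw [(Finset.mem_filter.1 hx).2]
  have hcsq : ∀ i, ∑ z, (c i z : ℝ) ^ 2 ≤ 16 * t := by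
    intro i
    have h1 : ∀ z, (c i z) ^ 2 ≤ 2 * #{x ∈ S i | p x = z} := by
      intro z
      have h2 : |c i z| ≤ #{x ∈ S i | p x = z} := by
        refine (Finset.abs_sum_le_sum_abs _ _).trans ?_
        refine (Finset.sum_le_card_nsmul _ _ 1 fun x _ => ?_).trans (by simp)
        rcases hs x with h | h <;> simp [h]
      have h3 : (#{x ∈ S i | p x = z} : ℤ) ≤ 2 := by
        exact_mod_cast (Finset.card_le_card
          (Finset.filter_subset_filter _ (hSY i))).trans (hfib z)
      rw [← sq_abs]
      nlinarith [abs_nonneg (c i z)]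
    have h4 : ∑ z, (c i z) ^ 2 ≤ 2 * (8 * t) := by
      refine (Finset.sum_le_sum fun z _ => h1 z).trans ?_
      rw [← Finset.mul_sum]
      gcongr
      have h5 : ∑ z, #{x ∈ S i | p x = z} = #(S i) :=
        (Finset.card_eq_sum_card_fiberwise fun x _ => Finset.mem_coe.2 (Finset.mem_univ (p x))).symm
      have h6 := hS i
      rw [← h5] at h6
      exact_mod_cast h6
    have h5 : ∑ z, (c i z : ℝ) ^ 2 ≤ 2 * (8 * t) := by exact_mod_cast h4
    linarith
  obtain ⟨hpow, hexp, hdep⟩ := two_le_exp_mul ht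
  have hlocal : ∀ i (ω ω' : X → Bool), (∀ z ∈ (S i).image p, ω z = ω' z) →
      l ≤ |∑ z, (c i z : ℝ) * boolSign (ω z)| → l ≤ |∑ z, (c i z : ℝ) * boolSign (ω' z)| := by
    intro i ω ω' hωω' hAi
    rw [hcsum] at hAi ⊢
    rwa [Finset.sum_congr rfl fun x hx =>
      congrArg (fun b => s x * boolSign b) (hωω' (p x) (Finset.mem_image_of_mem p hx))] at hAi
  have hdegree : ∀ i (F : Finset κ),
      #{j ∈ F | ¬Disjoint ((S i).image p) ((S j).image p)} ≤ 16 * t ^ 2 := by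
    intro i F
    have hsub : {j ∈ F | ¬Disjoint ((S i).image p) ((S j).image p)} ⊆
        (S i).biUnion fun x => ({y ∈ Y | p y = p x}).biUnion T := by
      intro j hj
      obtain ⟨z, hz1, hz2⟩ := Finset.not_disjoint_iff.1 (Finset.mem_filter.1 hj).2
      obtain ⟨x, hx, hxz⟩ := Finset.mem_image.1 hz1
      obtain ⟨y, hy, hyz⟩ := Finset.mem_image.1 hz2
      exact Finset.mem_biUnion.2 ⟨x, hx, Finset.mem_biUnion.2 ⟨y,
        Finset.mem_filter.2 ⟨hSY j hy, hyz.trans hxz.symm⟩, hST j y hy⟩⟩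
    refine (Finset.card_le_card hsub).trans
      ((Finset.card_biUnion_le_card_mul _ _ (2 * t) fun x _ => ?_).trans ?_)
    · exact (Finset.card_biUnion_le_card_mul _ _ t fun y _ => hT y).trans
        (Nat.mul_le_mul_right t (hfib _))
    · calc _ ≤ 8 * t * (2 * t) := Nat.mul_le_mul_right _ (hS i)
        _ = _ := by ring
  obtain ⟨ω, hω⟩ := exists_forall_not_of_local
    (fun i (ω : X → Bool) => l ≤ |∑ z, (c i z : ℝ) * boolSign (ω z)|)
    (fun i => (S i).image p) hlocal
    (fun i => (card_filter_le_abs_sum_boolSign (c i) (by positivity) (hcsq i) hl0).trans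
      (mul_le_mul_of_nonneg_right hexp (by positivity)))
    (fun i F => by convert hdegree i F) (by positivity) (by
      rw [mul_div_assoc', div_lt_one (by positivity)]
      linarith) hdep F
  refine ⟨ω, fun i hi => ?_⟩
  have h1 := hω i hi
  rwa [hcsum, not_le, ← Int.cast_abs, Int.abs_eq_natAbs, Int.cast_natCast] at h1

/-- Discrepancy bound when the large sets can be peeled off one at a time: pairs inside the large
sets get opposite signs, and the local lemma chooses the remaining signs for the small sets. -/
theorem herdisc_le_of_peeling {n m t : ℕ} (ht : 2 ≤ t) (T : Fin n → Finset (Fin m))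
    (hT : ∀ x, #(T x) ≤ t)
    (h : ∀ A ⊆ ({i | 8 * t ≤ #(setsOf T i)} : Finset (Fin m)), A.Nonempty →
      ∃ i ∈ A, #{x | i ∈ T x ∧ 2 ≤ #(T x ∩ A)} ≤ 7) :
    (herdisc (setsOf T) : ℝ) ≤ 20 * √(t * Real.log t) + 8 := by
  obtain ⟨a, haT, ha⟩ := exists_assignment T 7 _ h
  set l : ℝ := 20 * √(t * Real.log t) with hl
  have hl0 : 0 ≤ l := by positivity
  have hmem : ∀ x i, x ∈ setsOf T i ↔ i ∈ T x := fun x i => by simp [setsOf]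
  suffices hmain : herdisc (setsOf T) ≤ ⌊l⌋₊ + 8 by
    calc (herdisc (setsOf T) : ℝ) ≤ (⌊l⌋₊ + 8 : ℕ) := by exact_mod_cast hmain
      _ ≤ l + 8 := by push_cast; linarith [Nat.floor_le hl0]
  refine Finset.sup_le fun Y _ => ?_
  obtain ⟨p, s, hs, hpY, hfib, hsum⟩ := exists_pairing a Y
  obtain ⟨ω, hω⟩ := exists_signs_of_card_le ht T hT Y
    (fun i => if 8 * t ≤ #(setsOf T i) then ∅ else setsOf T i ∩ Y)
    (fun i => by split_ifs <;> simp [Finset.inter_subset_right])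
    (fun i x hx => by
      split_ifs at hx
      · simp at hx
      · exact (hmem x i).1 (Finset.mem_inter.1 hx).1)
    (fun i => by
      split_ifs with hi
      · simp
      · exact (Finset.card_le_card Finset.inter_subset_left).trans (not_le.1 hi).le)
    p s hs hfib univ
  have hsign : ∀ x, s x * boolSign (ω (p x)) = 1 ∨ s x * boolSign (ω (p x)) = -1 := fun x => by
    rcases hs x with h | h <;> rcases boolSign_eq (ω (p x)) with h' | h' <;> simp [h, h']
  refine disc_le (fun x => s x * boolSign (ω (p x))) hsign fun i => ?_
  by_cases hi : 8 * t ≤ #(setsOf T i)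
  · have hiF : i ∈ ({i | 8 * t ≤ #(setsOf T i)} : Finset (Fin m)) := by simpa using hi
    have hown : {x ∈ setsOf T i ∩ Y | a x = some i} = {x ∈ Y | a x = some i} := by
      ext x
      simp only [Finset.mem_filter, Finset.mem_inter]
      exact ⟨fun hx => ⟨hx.1.2, hx.2⟩, fun hx =>
        ⟨⟨(hmem x i).2 (Finset.mem_inter.1 (haT x i hx.2)).1, hx.1⟩, hx.2⟩⟩
    have h1 := hsum (some i) (fun z => boolSign (ω z)) fun z => boolSign_eq _
    have h2 : |∑ x ∈ setsOf T i ∩ Y with ¬a x = some i, s x * boolSign (ω (p x))| ≤ 7 := by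
      refine (Finset.abs_sum_le_sum_abs _ _).trans ?_
      refine (Finset.sum_le_card_nsmul _ _ 1 fun x _ => ?_).trans ?_
      · rcases hsign x with h | h <;> simp [h]
      · have : #{x ∈ setsOf T i ∩ Y | ¬a x = some i} ≤ 7 := by
          refine (Finset.card_le_card fun x hx => ?_).trans (ha i hiF)
          simp only [Finset.mem_filter, Finset.mem_inter, Finset.mem_univ, true_and, hmem] at hx ⊢
          exact ⟨hx.1.1, hx.2⟩
        rw [nsmul_eq_mul, mul_one]
        exact_mod_cast this
    have h3 : |∑ x ∈ setsOf T i ∩ Y, s x * boolSign (ω (p x))| ≤ 8 := by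
      rw [← Finset.sum_filter_add_sum_filter_not (setsOf T i ∩ Y) (fun x => a x = some i), hown]
      exact (abs_add_le _ _).trans (by linarith)
    rw [Int.abs_eq_natAbs] at h3
    exact (Int.ofNat_le.1 h3).trans (Nat.le_add_left _ _)
  · have h1 := hω i (Finset.mem_univ _)
    simp only [hi, if_false] at h1
    exact (Nat.le_floor h1.le).trans (Nat.le_add_right _ _)

theorem choose_sub_mul_pow_le {m t : ℕ} (htm : t ≤ m) {j : ℕ} (hj : j ≤ t) :
    (m - j).choose (t - j) * m ^ j ≤ t ^ j * m.choose t := by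
  induction j with
  | zero => simp
  | succ j ih =>
    have ih := ih (by lia)
    have h1 := Nat.add_one_mul_choose_eq (m - (j + 1)) (t - (j + 1))
    rw [show m - (j + 1) + 1 = m - j by lia, show t - (j + 1) + 1 = t - j by lia] at h1
    have h2 : (t - j) * m ≤ t * (m - j) := by
      zify [show j ≤ t by lia, show j ≤ m by lia]
      have : (t : ℤ) ≤ m := by exact_mod_cast htm
      nlinarith
    refine Nat.le_of_mul_le_mul_left ?_ (show 0 < m - j by lia)
    calc (m - j) * ((m - (j + 1)).choose (t - (j + 1)) * m ^ (j + 1))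
        = ((m - j) * (m - (j + 1)).choose (t - (j + 1))) * m ^ j * m := by ring
      _ = ((m - j).choose (t - j) * m ^ j) * ((t - j) * m) := by rw [h1]; ring
      _ ≤ (t ^ j * m.choose t) * (t * (m - j)) := Nat.mul_le_mul ih h2
      _ = _ := by ring

/-- A random `t`-subset of an `m`-set contains `B` with probability at most `(t / m) ^ #B`. -/
theorem card_filter_superset_le {m t : ℕ} (hm : 0 < m) (htm : t ≤ m) (B : Finset (Fin m)) :
    (#{S ∈ powersetCard t univ | B ⊆ S} : ℝ) ≤ m.choose t * ((t : ℝ) / m) ^ #B := by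
  have hm' : (0 : ℝ) < m := by exact_mod_cast hm
  by_cases hB : #B ≤ t
  · have h1 := card_filter_powersetCard_subset B univ t (subset_univ B) hB
    rw [Finset.card_univ, Fintype.card_fin] at h1
    have h2 := choose_sub_mul_pow_le htm hB
    rw [div_pow, mul_div_assoc', le_div_iff₀ (by positivity), mul_comm (m.choose t : ℝ)]
    have h3 : #{S ∈ powersetCard t univ | B ⊆ S} * m ^ #B ≤ t ^ #B * m.choose t := by
      refine le_trans (le_of_eq ?_) h2
      rw [← h1]
    exact_mod_cast h3
  · rw [Finset.filter_eq_empty_iff.2 fun S hS hBS => hB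
      ((Finset.card_le_card hBS).trans_eq (Finset.mem_powersetCard.1 hS).2)]
    simp only [Finset.card_empty, Nat.cast_zero]
    positivity

theorem sparseChoices_eq (n m t : ℕ) :
    sparseChoices n m t = Fintype.piFinset fun _ : Fin n => powersetCard t univ := by
  ext T
  simp [sparseChoices]

theorem card_sparseChoices (n m t : ℕ) : #(sparseChoices n m t) = m.choose t ^ n := by
  simp [sparseChoices_eq]

/-- Exponential-moment tail bound for a sum of a statistic over independent random subsets. -/
theorem card_filter_sparseChoices_mul_pow_le (n m t : ℕ) (f : Finset (Fin m) → ℕ) (K : ℕ) {l : ℝ}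
    (hl : 1 ≤ l) :
    (#{T ∈ sparseChoices n m t | K ≤ ∑ x, f (T x)} : ℝ) * l ^ K ≤
      (∑ S ∈ powersetCard t univ, l ^ f S) ^ n := by
  have h1 : (∑ S ∈ powersetCard t univ, l ^ f S) ^ n =
      ∑ T ∈ sparseChoices n m t, l ^ ∑ x, f (T x) := by
    simp_rw [← Finset.prod_pow_eq_pow_sum]
    rw [sparseChoices_eq, Finset.sum_pow']
  rw [h1, ← nsmul_eq_mul]
  refine (Finset.card_nsmul_le_sum _ _ _ fun T hT => ?_).trans
    (Finset.sum_le_sum_of_subset_of_nonneg (Finset.filter_subset _ _) fun _ _ _ => by positivity)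
  exact pow_le_pow_right₀ hl (Finset.mem_filter.1 hT).2

theorem mul_one_add_pow_le {M a b : ℝ} (n : ℕ) (hM : 0 ≤ M) (ha : 0 ≤ a) (hb : n * a ≤ b) :
    (M * (1 + a)) ^ n ≤ M ^ n * Real.exp b := by
  rw [mul_pow]
  gcongr
  calc (1 + a) ^ n ≤ Real.exp a ^ n := by
        gcongr
        linarith [Real.add_one_le_exp a]
    _ = Real.exp (n * a) := (Real.exp_nat_mul a n).symm
    _ ≤ _ := Real.exp_le_exp.2 hb

/-- A given set of the random system is large with exponentially small probability. -/
theorem card_filter_large_le {n m t : ℕ} (hm : 0 < m) (htm : t ≤ m) (hnm : n ≤ m) (i : Fin m) :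
    (#{T ∈ sparseChoices n m t | 8 * t ≤ #(setsOf T i)} : ℝ) * 2 ^ (8 * t) ≤
      #(sparseChoices n m t) * Real.exp t := by
  have hm' : (0 : ℝ) < m := by exact_mod_cast hm
  have h1 := card_filter_sparseChoices_mul_pow_le n m t (fun S => if i ∈ S then 1 else 0)
    (8 * t) one_le_two
  have h2 : ∀ T : Fin n → Finset (Fin m), ∑ x, (if i ∈ T x then 1 else 0) = #(setsOf T i) :=
    fun T => by simp [setsOf]
  simp_rw [h2] at h1
  refine h1.trans ?_
  have h3 : ∑ S ∈ powersetCard t (univ : Finset (Fin m)), (2 : ℝ) ^ (if i ∈ S then 1 else 0) ≤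
      m.choose t * (1 + t / m) := by
    have h4 : ∀ S : Finset (Fin m), (2 : ℝ) ^ (if i ∈ S then 1 else 0) =
        1 + if i ∈ S then 1 else 0 := fun S => by split_ifs <;> norm_num
    simp_rw [h4]
    have h5 := card_filter_superset_le hm htm {i}
    simp only [Finset.singleton_subset_iff, Finset.card_singleton, pow_one] at h5
    rw [Finset.sum_add_distrib, Finset.sum_boole]
    simp only [Finset.sum_const, Finset.card_powersetCard, Finset.card_univ, Fintype.card_fin,
      nsmul_eq_mul, mul_one]
    linarith
  rw [card_sparseChoices]
  push_cast
  refine (pow_le_pow_left₀ (Finset.sum_nonneg fun _ _ => by positivity) h3 n).trans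
    (mul_one_add_pow_le n (by positivity) (by positivity) ?_)
  rw [mul_div_assoc', div_le_iff₀ hm', mul_comm]
  gcongr

/-- The number of incidences of `S` with `A`, if there are at least two of them. -/
def sharedCard {α : Type*} [DecidableEq α] (A S : Finset α) : ℕ :=
  if 2 ≤ #(S ∩ A) then #(S ∩ A) else 0

theorem sum_powerset_two_le_card {α : Type*} (A : Finset α) {v : ℝ} (hv : 0 ≤ v)
    (hu : #A * v ≤ 1) : ∑ B ∈ A.powerset with 2 ≤ #B, v ^ #B ≤ (#A * v) ^ 2 := by
  have h1 : ∑ B ∈ A.powerset, v ^ #B = (1 + v) ^ #A := by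
    rw [add_comm, ← Finset.sum_pow_mul_eq_add_pow]
    simp
  have h2 : ∑ B ∈ A.powerset with ¬2 ≤ #B, v ^ #B = 1 + #A * v := by
    have h3 : {B ∈ A.powerset | ¬2 ≤ #B} = powersetCard 0 A ∪ powersetCard 1 A := by
      ext B
      simp only [Finset.mem_filter, Finset.mem_powerset, Finset.mem_union,
        Finset.mem_powersetCard]
      grind
    rw [h3, Finset.sum_union, Finset.sum_congr (s₁ := powersetCard 1 A) rfl fun B hB => by
      rw [(Finset.mem_powersetCard.1 hB).2]]
    · simp
    · rw [Finset.disjoint_left]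
      intro B hB hB'
      have := (Finset.mem_powersetCard.1 hB).2
      have := (Finset.mem_powersetCard.1 hB').2
      lia
  have h4 := Finset.sum_filter_add_sum_filter_not A.powerset (fun B => 2 ≤ #B) (fun B => v ^ #B)
  have h5 : (1 + v) ^ #A ≤ Real.exp (#A * v) := by
    rw [Real.exp_nat_mul]
    gcongr
    linarith [Real.add_one_le_exp v]
  have hu0 : 0 ≤ #A * v := by positivity
  have h6 := (abs_le.1 (Real.abs_exp_sub_one_sub_id_le (x := #A * v)
    (by rwa [abs_of_nonneg hu0]))).2
  linarith

theorem sum_pow_sharedCard_le {m t : ℕ} (hm : 0 < m) (htm : t ≤ m) (A : Finset (Fin m)) {l : ℝ}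
    (hl : 0 ≤ l) (hu : #A * (l * (t / m)) ≤ 1) :
    ∑ S ∈ powersetCard t univ, l ^ sharedCard A S ≤
      m.choose t * (1 + (#A * (l * (t / m))) ^ 2) := by
  have h1 : ∀ S : Finset (Fin m), l ^ sharedCard A S ≤
      1 + ∑ B ∈ A.powerset with 2 ≤ #B, if B ⊆ S then l ^ #B else 0 := by
    intro S
    have hnn : ∀ B ∈ {B ∈ A.powerset | 2 ≤ #B}, 0 ≤ if B ⊆ S then l ^ #B else 0 :=
      fun B _ => by split_ifs <;> positivity
    by_cases hS : 2 ≤ #(S ∩ A)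
    · have h2 := Finset.single_le_sum hnn (a := S ∩ A)
        (by simp [hS, Finset.inter_subset_right])
      rw [if_pos Finset.inter_subset_left] at h2
      rw [sharedCard, if_pos hS]
      linarith
    · rw [sharedCard, if_neg hS, pow_zero]
      linarith [Finset.sum_nonneg hnn]
  refine (Finset.sum_le_sum fun S _ => h1 S).trans ?_
  rw [Finset.sum_add_distrib, Finset.sum_comm]
  have h3 : ∀ B : Finset (Fin m), ∑ S ∈ powersetCard t univ, (if B ⊆ S then l ^ #B else 0) ≤
      m.choose t * (l * (t / m)) ^ #B := by
    intro B
    rw [← Finset.sum_filter, Finset.sum_const, nsmul_eq_mul, mul_pow, mul_left_comm, mul_comm]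
    gcongr
    exact card_filter_superset_le hm htm B
  have h4 := sum_powerset_two_le_card A (v := l * (t / m)) (by positivity) hu
  calc _ ≤ (m.choose t : ℝ) + ∑ B ∈ A.powerset with 2 ≤ #B, m.choose t * (l * (t / m)) ^ #B := by
        refine add_le_add (by simp) (Finset.sum_le_sum fun B _ => h3 B)
    _ ≤ m.choose t + m.choose t * (#A * (l * (t / m))) ^ 2 := by
        rw [← Finset.mul_sum]
        gcongr
    _ = _ := by ring

/-- For a small family `A`, it is very unlikely that the sets of `A` share on average at least
eight elements with each other. -/
theorem card_filter_shared_le {n m t : ℕ} (ht : 0 < t) (htm : t ≤ m) (hnm : n ≤ m)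
    (A : Finset (Fin m)) (hA : 0 < #A) (hAm : #A * t ^ 2 ≤ m) :
    (#{T ∈ sparseChoices n m t | 8 * #A ≤ ∑ x, sharedCard A (T x)} : ℝ) ≤
      #(sparseChoices n m t) * (Real.exp #A * (#A * t ^ 2 / m) ^ (4 * #A)) := by
  have hm : 0 < m := ht.trans_le htm
  have hm' : (0 : ℝ) < m := by exact_mod_cast hm
  have ht' : (1 : ℝ) ≤ t := by exact_mod_cast ht
  have hA' : (0 : ℝ) < #A := by exact_mod_cast hA
  have hAm' : (#A : ℝ) * t ^ 2 ≤ m := by exact_mod_cast hAm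
  set q : ℝ := m / (#A * t ^ 2) with hq
  have hq1 : 1 ≤ q := (one_le_div (by positivity)).2 hAm'
  have hl1 : 1 ≤ √q := Real.one_le_sqrt.2 hq1
  have hsq : √q ^ 2 = q := Real.sq_sqrt (by linarith)
  have hu2 : (#A * (√q * (t / m))) ^ 2 = (#A : ℝ) / m := by
    rw [mul_pow, mul_pow, hsq, hq]
    field_simp
  have hAm1 : (#A : ℝ) / m ≤ 1 := by
    rw [div_le_one hm']
    refine le_trans ?_ hAm'
    exact le_mul_of_one_le_right hA'.le (one_le_pow₀ ht')
  have hu : #A * (√q * (t / m)) ≤ 1 := by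
    refine (sq_le_one_iff₀ (by positivity)).1 ?_
    rw [hu2]
    exact hAm1
  have h1 := card_filter_sparseChoices_mul_pow_le n m t (sharedCard A) (8 * #A) hl1
  have h2 := sum_pow_sharedCard_le hm htm A (l := √q) (by positivity) hu
  rw [hu2] at h2
  have h3 := h1.trans ((pow_le_pow_left₀ (Finset.sum_nonneg fun _ _ => by positivity) h2 n).trans
    (mul_one_add_pow_le (b := #A) n (by positivity) (by positivity) (by
      rw [mul_div_assoc', div_le_iff₀ hm', mul_comm]
      gcongr)))
  have hpow : √q ^ (8 * #A) = q ^ (4 * #A) := by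
    rw [show 8 * #A = 2 * (4 * #A) by ring, pow_mul, hsq]
  rw [hpow, ← le_div_iff₀ (by positivity)] at h3
  refine h3.trans_eq ?_
  rw [card_sparseChoices]
  push_cast
  rw [mul_div_assoc, div_eq_mul_inv, ← inv_pow, hq, inv_div]

theorem sum_card_filter_shared_eq {n m : ℕ} (T : Fin n → Finset (Fin m)) (A : Finset (Fin m)) :
    ∑ i ∈ A, #{x | i ∈ T x ∧ 2 ≤ #(T x ∩ A)} = ∑ x, sharedCard A (T x) := by
  simp_rw [Finset.card_filter]
  rw [Finset.sum_comm]
  refine Finset.sum_congr rfl fun x _ => ?_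
  rw [← Finset.card_filter, sharedCard]
  split_ifs with h
  · congr 1
    ext i
    simp only [Finset.mem_filter, Finset.mem_inter, h, and_true]
    exact and_comm
  · simp [h]

/-- The indices of the sets with at least `8 * t` elements. -/
noncomputable def largeIndices {n m : ℕ} (t : ℕ) (T : Fin n → Finset (Fin m)) : Finset (Fin m) :=
  {i | 8 * t ≤ #(setsOf T i)}

theorem exp_nat_le_two_pow (t : ℕ) : Real.exp t ≤ 2 ^ (2 * t) := by
  have h : Real.exp 1 ≤ 2 ^ 2 := by linarith [Real.exp_one_lt_d9]
  calc Real.exp t = Real.exp 1 ^ t := by rw [← Real.exp_nat_mul, mul_one]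
    _ ≤ (2 ^ 2) ^ t := by gcongr
    _ = _ := (pow_mul 2 2 t).symm

/-- It is unlikely that there are many large sets. -/
theorem card_filter_many_large_le {n m t : ℕ} (ht : 0 < t) (htm : t ≤ m) (hnm : n ≤ m) :
    (#{T ∈ sparseChoices n m t | m < #(largeIndices t T) * t ^ 5} : ℝ) ≤
      #(sparseChoices n m t) / t := by
  have hm : 0 < m := ht.trans_le htm
  have hm' : (0 : ℝ) < m := by exact_mod_cast hm
  have ht' : (0 : ℝ) < t := by exact_mod_cast ht
  have ht2 : (t : ℝ) ≤ 2 ^ t := by exact_mod_cast (Nat.lt_two_pow_self (n := t)).le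
  set N : ℝ := (#(sparseChoices n m t) : ℝ)
  have h1 : (#{T ∈ sparseChoices n m t | m < #(largeIndices t T) * t ^ 5} : ℝ) * m ≤
      ∑ T ∈ sparseChoices n m t, (#(largeIndices t T) : ℝ) * t ^ 5 := by
    rw [← nsmul_eq_mul]
    refine (Finset.card_nsmul_le_sum _ _ _ fun T hT => ?_).trans
      (Finset.sum_le_sum_of_subset_of_nonneg (Finset.filter_subset _ _)
        fun _ _ _ => by positivity)
    exact_mod_cast (Finset.mem_filter.1 hT).2.le
  have h2 : ∑ T ∈ sparseChoices n m t, (#(largeIndices t T) : ℝ) =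
      ∑ i, (#{T ∈ sparseChoices n m t | 8 * t ≤ #(setsOf T i)} : ℝ) := by
    simp_rw [largeIndices, Finset.card_filter]
    push_cast
    exact Finset.sum_comm
  have h3 : ∀ i, (#{T ∈ sparseChoices n m t | 8 * t ≤ #(setsOf T i)} : ℝ) ≤ N / 2 ^ (6 * t) := by
    intro i
    rw [le_div_iff₀ (by positivity)]
    have h4 := (card_filter_large_le hm htm hnm i).trans
      (mul_le_mul_of_nonneg_left (exp_nat_le_two_pow t) (by positivity))
    rw [show 8 * t = 6 * t + 2 * t by ring, pow_add, ← mul_assoc] at h4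
    rw [show 6 * t + 2 * t = 8 * t by ring] at h4
    exact le_of_mul_le_mul_right h4 (by positivity)
  rw [← Finset.sum_mul, h2] at h1
  have h5 : (t : ℝ) ^ 5 * t ≤ 2 ^ (6 * t) := by
    calc (t : ℝ) ^ 5 * t = t ^ 6 := by ring
      _ ≤ (2 ^ t) ^ 6 := by gcongr
      _ = _ := by rw [← pow_mul, mul_comm]
  refine le_of_mul_le_mul_right (h1.trans ?_) hm'
  calc _ ≤ (∑ _i : Fin m, N / 2 ^ (6 * t)) * t ^ 5 := by
        gcongr with i
        exact h3 i
    _ = m * N * (t ^ 5 / 2 ^ (6 * t)) := by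
        simp only [Finset.sum_const, Finset.card_univ, Fintype.card_fin, nsmul_eq_mul]
        ring
    _ ≤ m * N * (1 / t) := by
        refine mul_le_mul_of_nonneg_left ?_ (by positivity)
        rw [div_le_div_iff₀ (by positivity) ht', one_mul]
        exact h5
    _ = _ := by ring

theorem choose_mul_exp_mul_pow_le {m t a : ℕ} (ht : 2 ≤ t) (hm : 0 < m) (ha : 0 < a)
    (ham : a * t ^ 5 ≤ m) :
    m.choose a * (Real.exp a * (a * t ^ 2 / m : ℝ) ^ (4 * a)) ≤ 1 / t * (1 / 2) ^ a := by
  have hm' : (0 : ℝ) < m := by exact_mod_cast hm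
  have ha' : (0 : ℝ) < a := by exact_mod_cast ha
  have ht' : (2 : ℝ) ≤ t := by exact_mod_cast ht
  have ham' : (a : ℝ) * t ^ 5 ≤ m := by exact_mod_cast ham
  have h1 : (m.choose a : ℝ) ≤ Real.exp a * (m / a) ^ a := by
    have h2 := Nat.choose_le_pow_div (α := ℝ) a m
    have h3 := Real.pow_div_factorial_le_exp (x := (a : ℝ)) ha'.le a
    calc (m.choose a : ℝ) ≤ m ^ a / a.factorial := h2
      _ = a ^ a / a.factorial * (m / a) ^ a := by
        rw [div_pow]
        field_simp
      _ ≤ _ := by gcongr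
  have he : Real.exp 1 ^ 2 ≤ 8 := by nlinarith [Real.exp_one_lt_d9, Real.exp_pos 1]
  have h4 : Real.exp 1 ^ 2 * t ^ 8 * (a / m : ℝ) ^ 3 ≤ (1 / t) * (1 / 2 : ℝ) := by
    have h5 : (a / m : ℝ) ≤ 1 / t ^ 5 := by
      rw [div_le_div_iff₀ hm' (by positivity)]
      linarith
    calc Real.exp 1 ^ 2 * t ^ 8 * (a / m : ℝ) ^ 3 ≤ 8 * t ^ 8 * (1 / t ^ 5 : ℝ) ^ 3 := by gcongr
      _ = 1 / t * (8 / t ^ 6 : ℝ) := by field_simp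
      _ ≤ _ := by
        refine mul_le_mul_of_nonneg_left ?_ (by positivity)
        rw [div_le_div_iff₀ (by positivity) two_pos]
        have : (2 : ℝ) ^ 6 ≤ t ^ 6 := by gcongr
        linarith
  calc _ ≤ Real.exp a * (m / a) ^ a * (Real.exp a * (a * t ^ 2 / m : ℝ) ^ (4 * a)) := by gcongr
    _ = (Real.exp 1 ^ 2 * t ^ 8 * (a / m : ℝ) ^ 3) ^ a := by
        rw [show Real.exp a = Real.exp 1 ^ a by rw [← Real.exp_nat_mul, mul_one], pow_mul,
          ← mul_pow, ← mul_pow, ← mul_pow]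
        congr 1
        field_simp
    _ ≤ (1 / t * (1 / 2)) ^ a := by gcongr
    _ ≤ _ := by
        rw [mul_pow]
        gcongr
        exact pow_le_of_le_one (by positivity) (by rw [div_le_one] <;> linarith) ha.ne'

/-- It is unlikely that some small family of sets shares many elements. -/
theorem card_filter_exists_shared_le {n m t : ℕ} (ht : 2 ≤ t) (htm : t ≤ m) (hnm : n ≤ m) :
    (#{T ∈ sparseChoices n m t | ∃ A : Finset (Fin m), A.Nonempty ∧ #A * t ^ 5 ≤ m ∧
      8 * #A ≤ ∑ x, sharedCard A (T x)} : ℝ) ≤ #(sparseChoices n m t) * (2 / t) := by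
  have hm : 0 < m := by lia
  set N : ℝ := (#(sparseChoices n m t) : ℝ)
  let P : Finset (Finset (Fin m)) := {A | A.Nonempty ∧ #A * t ^ 5 ≤ m}
  have h1 : (#{T ∈ sparseChoices n m t | ∃ A : Finset (Fin m), A.Nonempty ∧ #A * t ^ 5 ≤ m ∧
      8 * #A ≤ ∑ x, sharedCard A (T x)} : ℝ) ≤
      ∑ A ∈ P, (#{T ∈ sparseChoices n m t | 8 * #A ≤ ∑ x, sharedCard A (T x)} : ℝ) := by
    have h2 : {T ∈ sparseChoices n m t | ∃ A : Finset (Fin m), A.Nonempty ∧ #A * t ^ 5 ≤ m ∧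
        8 * #A ≤ ∑ x, sharedCard A (T x)} ⊆
        P.biUnion fun A => {T ∈ sparseChoices n m t | 8 * #A ≤ ∑ x, sharedCard A (T x)} := by
      intro T hT
      obtain ⟨hT, A, hA, hAm, h⟩ := Finset.mem_filter.1 hT
      exact Finset.mem_biUnion.2 ⟨A, by simp [P, hA, hAm], by simp [hT, h]⟩
    exact_mod_cast (Finset.card_le_card h2).trans Finset.card_biUnion_le
  let g : ℕ → ℝ := fun a => if 0 < a ∧ a * t ^ 5 ≤ m then
    N * (Real.exp a * (a * t ^ 2 / m) ^ (4 * a)) else 0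
  refine h1.trans ?_
  calc ∑ A ∈ P, (#{T ∈ sparseChoices n m t | 8 * #A ≤ ∑ x, sharedCard A (T x)} : ℝ)
      ≤ ∑ A ∈ P, g #A := by
        refine Finset.sum_le_sum fun A hA => ?_
        obtain ⟨hA, hAm⟩ := (Finset.mem_filter.1 hA).2
        have hA0 := Finset.card_pos.2 hA
        rw [show g #A = _ from if_pos ⟨hA0, hAm⟩]
        refine card_filter_shared_le (by lia) htm hnm A hA0 (le_trans ?_ hAm)
        gcongr
        · lia
        · lia
    _ ≤ ∑ A ∈ (univ : Finset (Fin m)).powerset, g #A := by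
        refine Finset.sum_le_sum_of_subset_of_nonneg (by simp) fun A _ _ => ?_
        simp only [g]
        split_ifs <;> positivity
    _ = ∑ a ∈ Finset.range (m + 1), m.choose a * g a := by
        rw [Finset.sum_powerset_apply_card]
        simp
    _ ≤ ∑ a ∈ Finset.range (m + 1), N * (1 / t) * (1 / 2) ^ a := by
        refine Finset.sum_le_sum fun a _ => ?_
        by_cases ha : 0 < a ∧ a * t ^ 5 ≤ m
        · rw [show g a = _ from if_pos ha, mul_left_comm, mul_assoc]
          exact mul_le_mul_of_nonneg_left (choose_mul_exp_mul_pow_le ht hm ha.1 ha.2)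
            (Nat.cast_nonneg _)
        · rw [show g a = _ from if_neg ha, mul_zero]
          positivity
    _ ≤ N * (1 / t) * 2 := by
        rw [← Finset.mul_sum]
        gcongr
        exact sum_geometric_two_le (m + 1)
    _ = _ := by ring

theorem herdisc_setsOf_le_two_mul {n m t : ℕ} {T : Fin n → Finset (Fin m)}
    (hT : T ∈ sparseChoices n m t) : herdisc (setsOf T) ≤ 2 * t := by
  refine herdisc_le_of_sparse _ fun x => ?_
  rw [← (Finset.mem_filter.1 hT).2 x]
  exact Finset.card_le_card fun i hi => by simpa [setsOf] using hi

theorem herdisc_setsOf_le_of_few_shared {n m t : ℕ} (ht : 2 ≤ t) {T : Fin n → Finset (Fin m)}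
    (hT : T ∈ sparseChoices n m t) (hlarge : #(largeIndices t T) * t ^ 5 ≤ m)
    (hshared : ∀ A : Finset (Fin m), A.Nonempty → #A * t ^ 5 ≤ m →
      ∑ x, sharedCard A (T x) < 8 * #A) :
    (herdisc (setsOf T) : ℝ) ≤ 20 * √(t * Real.log t) + 8 := by
  refine herdisc_le_of_peeling ht T (fun x => ((Finset.mem_filter.1 hT).2 x).le)
    fun A hA hne => ?_
  have h1 := hshared A hne (le_trans (Nat.mul_le_mul_right _ (Finset.card_le_card hA)) hlarge)
  rw [← sum_card_filter_shared_eq] at h1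
  by_contra! h
  have h2 := Finset.card_nsmul_le_sum A _ 8 fun i hi => h i hi
  rw [smul_eq_mul] at h2
  lia

theorem one_le_mul_log {t : ℕ} (ht : 2 ≤ t) : 1 ≤ (t : ℝ) * Real.log t := by
  have ht' : (2 : ℝ) ≤ t := by exact_mod_cast ht
  have h1 : Real.log 2 ≤ Real.log t := Real.log_le_log two_pos ht'
  nlinarith [Real.log_two_gt_d9]

/-- For `m ≥ n ≥ t ≥ 2`, a random `t`-sparse set system with `|X| = n`, `|Σ| = m`
has expected hereditary discrepancy at most `C √(t log t)`. -/
theorem random_herdisc_expectation :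
    ∃ C : ℝ, 0 < C ∧ ∀ m n t : ℕ, 2 ≤ t → t ≤ n → n ≤ m →
      (∑ T ∈ sparseChoices n m t, (herdisc (setsOf T) : ℝ)) / (sparseChoices n m t).card
        ≤ C * Real.sqrt (t * Real.log t) := by
  refine ⟨34, by norm_num, fun m n t ht htn hnm => ?_⟩
  have ht' : (0 : ℝ) < t := by positivity
  have hr : 1 ≤ √(t * Real.log t) := Real.one_le_sqrt.2 (one_le_mul_log ht)
  have h1 := card_filter_many_large_le (by lia) (htn.trans hnm) hnm
  have h2 := card_filter_exists_shared_le ht (htn.trans hnm) hnm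
  set Ω := sparseChoices n m t
  set E₁ : Finset (Fin n → Finset (Fin m)) := {T ∈ Ω | m < #(largeIndices t T) * t ^ 5}
  set E₂ : Finset (Fin n → Finset (Fin m)) := {T ∈ Ω | ∃ A : Finset (Fin m), A.Nonempty ∧
    #A * t ^ 5 ≤ m ∧ 8 * #A ≤ ∑ x, sharedCard A (T x)}
  have h3 : ∀ T ∈ Ω, (herdisc (setsOf T) : ℝ) ≤ (20 * √(t * Real.log t) + 8) +
      ((if T ∈ E₁ then (2 * t : ℝ) else 0) + (if T ∈ E₂ then (2 * t : ℝ) else 0)) := by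
    intro T hT
    have hbad : (herdisc (setsOf T) : ℝ) ≤ 2 * t := by
      exact_mod_cast herdisc_setsOf_le_two_mul hT
    by_cases hT₁ : T ∈ E₁
    · rw [if_pos hT₁]
      split_ifs <;> linarith
    by_cases hT₂ : T ∈ E₂
    · rw [if_pos hT₂]
      split_ifs
      linarith
    rw [if_neg hT₁, if_neg hT₂, add_zero, add_zero]
    refine herdisc_setsOf_le_of_few_shared ht hT ?_ fun A hA hAm => ?_
    · by_contra! h
      exact hT₁ (Finset.mem_filter.2 ⟨hT, h⟩)
    · by_contra! h
      exact hT₂ (Finset.mem_filter.2 ⟨hT, A, hA, hAm, h⟩)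
  refine div_le_of_le_mul₀ (by positivity) (by positivity) ((Finset.sum_le_sum h3).trans ?_)
  have h4 : ∀ E ⊆ Ω, ∑ T ∈ Ω, (if T ∈ E then (2 * t : ℝ) else 0) = #E * (2 * t) := by
    intro E hE
    rw [Finset.sum_ite_mem, Finset.inter_eq_right.2 hE, Finset.sum_const, nsmul_eq_mul]
  rw [Finset.sum_add_distrib, Finset.sum_const, nsmul_eq_mul, Finset.sum_add_distrib,
    h4 E₁ (Finset.filter_subset _ _),
    h4 E₂ (Finset.filter_subset _ _)]
  have h5 : #E₁ * (2 * t : ℝ) ≤ #Ω * 2 := by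
    calc #E₁ * (2 * t : ℝ) ≤ #Ω / t * (2 * t) := by gcongr
      _ = _ := by field_simp
  have h6 : #E₂ * (2 * t : ℝ) ≤ #Ω * 4 := by
    calc #E₂ * (2 * t : ℝ) ≤ #Ω * (2 / t) * (2 * t) := by gcongr
      _ = _ := by field_simp; norm_num
  nlinarith [mul_le_mul_of_nonneg_left hr (Nat.cast_nonneg (α := ℝ) #Ω)]
end
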